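/- Let n ≥ 1 with n ≢ 1 (mod q−1), and let φ be the canonical Carlitz deformation over A[t₁,…,t_n]. Let 𝓜(φ) = {φ_a(u) : a ∈ A[t₁,…,t_n]} where u = u_C(t₁,…,t_n;1) = exp_φ(𝓛(φ/𝔸)). Then 𝓜(φ) equals its radical: for every b ∈ A[t₁,…,t_n], if φ_a(b) ∈ 𝓜(φ) for some nonzero a ∈ A[t₁,…,t_n], then b ∈ 𝓜(φ). -/

import Mathlib

open Polynomial

section TateAlgebra

variable (Fq : Type*) [Field Fq] (n : ℕ)

/- The Tate algebra `T_n(K_∞)` is realized as the ring of Laurent series in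
`u = 1/θ` with coefficients in `F_q[t₁,…,t_n]`. -/

/-- `θ = u⁻¹` inside the Tate algebra. -/
noncomputable def thetaTate : LaurentSeries (MvPolynomial (Fin n) Fq) :=
  HahnSeries.single (-1 : ℤ) 1

/-- The embedding of `A = F_q[θ]` into the Tate algebra, `a ↦ a(θ)`. -/
noncomputable def polyToTate (a : Polynomial Fq) :
    LaurentSeries (MvPolynomial (Fin n) Fq) :=
  Polynomial.aeval (thetaTate Fq n) a

/-- `b_j(t₁)⋯b_j(t_n)` where `b_j(t) = ∏_{k<j} (t − θ^{q^k})`. -/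
noncomputable def tateBProd (q j : ℕ) : LaurentSeries (MvPolynomial (Fin n) Fq) :=
  ∏ i : Fin n, ∏ k ∈ Finset.range j,
    (HahnSeries.C (MvPolynomial.X i) - (thetaTate Fq n) ^ q ^ k)

/-- `a(t₁)⋯a(t_n)`, for `a ∈ A`. -/
noncomputable def tateAProd (a : Polynomial Fq) :
    LaurentSeries (MvPolynomial (Fin n) Fq) :=
  ∏ i : Fin n, HahnSeries.C (Polynomial.aeval (MvPolynomial.X i) a)

end TateAlgebra

/-- The Frobenius twist `τ` on `F_q[t₁,…,t_n][θ]`: it fixes the coefficients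
(in which only `F_q` and the `t_i` occur) and sends `θ ↦ θ^q`. -/
noncomputable def frobTwist (R : Type*) [CommSemiring R] (q : ℕ) :
    Polynomial R →ₗ[R] Polynomial R where
  toFun p := p.comp (Polynomial.X ^ q)
  map_add' a b := by simp [Polynomial.add_comp]
  map_smul' c p := by simp [Polynomial.smul_comp]

/-- The canonical Carlitz deformation `φ_θ = (t₁−θ)⋯(t_n−θ)τ + θ` as an
endomorphism of `R[θ]`, `R = F_q[t₁,…,t_n]`. -/
noncomputable def carlitzDefTheta (R : Type*) [CommRing R] (q : ℕ)
    (f : Polynomial R) : Module.End R (Polynomial R) :=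
  (LinearMap.mulLeft R f).comp (frobTwist R q) + LinearMap.mulLeft R Polynomial.X

section PartA
variable {R : Type*} [CommRing R] [IsDomain R] {q : ℕ} {f : R[X]}

lemma cdt_apply (x : R[X]) : carlitzDefTheta R q f x = f * x.comp (X ^ q) + X * x := by
  simp [carlitzDefTheta, frobTwist]

lemma cdt_deg (hq : 2 ≤ q) (hf : 2 ≤ f.natDegree) {x : R[X]} (hx : x ≠ 0) :
    (carlitzDefTheta R q f x).natDegree = f.natDegree + q * x.natDegree ∧
    (carlitzDefTheta R q f x).leadingCoeff = f.leadingCoeff * x.leadingCoeff := by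
  rw [cdt_apply]
  have hf0 : f ≠ 0 := by rintro rfl; simp at hf
  have h0 : x.comp (X ^ q) ≠ 0 := by
    rw [← Polynomial.expand_eq_comp_X_pow]
    exact (Polynomial.expand_ne_zero (by omega)).2 hx
  have h1 : (f * x.comp (X ^ q)).natDegree = f.natDegree + q * x.natDegree := by
    rw [natDegree_mul hf0 h0, natDegree_comp, natDegree_X_pow, mul_comm q]
  have h2 : (X * x).natDegree = x.natDegree + 1 := natDegree_X_mul hx
  have hlt : (X * x).degree < (f * x.comp (X ^ q)).degree := by
    apply degree_lt_degree
    rw [h1, h2]; nlinarith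
  constructor
  · rw [natDegree_add_eq_left_of_degree_lt hlt, h1]
  · rw [leadingCoeff_add_of_degree_lt' hlt, leadingCoeff_mul, ← Polynomial.expand_eq_comp_X_pow,
      leadingCoeff_expand (by omega)]

lemma cdt_aeval_deg (hq : 2 ≤ q) (hf : 2 ≤ f.natDegree) (m : ℕ) {a x : R[X]} (ha : a ≠ 0)
    (hm : a.natDegree = m) (hx : x ≠ 0) :
    aeval (carlitzDefTheta R q f) a x ≠ 0 ∧
    (aeval (carlitzDefTheta R q f) a x).natDegree =
      (fun e => f.natDegree + q * e)^[m] x.natDegree ∧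
    (aeval (carlitzDefTheta R q f) a x).leadingCoeff =
      a.leadingCoeff * f.leadingCoeff ^ m * x.leadingCoeff := by
  have hf0 : f ≠ 0 := by rintro rfl; simp at hf
  induction m generalizing a with
  | zero =>
    obtain ⟨c, rfl⟩ := natDegree_eq_zero.1 hm
    have hc : c ≠ 0 := by simpa using ha
    have : aeval (carlitzDefTheta R q f) (C c) x = C c * x := by
      simp [Module.algebraMap_end_apply, smul_eq_C_mul]
    rw [this]
    refine ⟨mul_ne_zero ha hx, ?_, ?_⟩
    · simp [natDegree_C_mul hc]
    · simp [leadingCoeff_mul]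
  | succ m ih =>
    have hd : a.divX.natDegree = m := by rw [natDegree_divX_eq_natDegree_tsub_one, hm]; rfl
    have hd0 : a.divX ≠ 0 := by
      intro h
      rw [divX_eq_zero_iff] at h
      rw [h, natDegree_C] at hm; omega
    obtain ⟨i0, i1, i2⟩ := ih hd0 hd
    have key : aeval (carlitzDefTheta R q f) a x =
        carlitzDefTheta R q f (aeval (carlitzDefTheta R q f) a.divX x) + C (a.coeff 0) * x := by
      conv_lhs => rw [← X_mul_divX_add a]
      simp only [map_add, map_mul, aeval_X, aeval_C, LinearMap.add_apply, Module.End.mul_apply,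
        Module.algebraMap_end_apply, smul_eq_C_mul]
    obtain ⟨j1, j2⟩ := cdt_deg (q := q) (f := f) hq hf i0
    have hge : ∀ m d, d ≤ (fun e => f.natDegree + q * e)^[m] d := by
      intro m d
      induction m with
      | zero => simp
      | succ m ih => rw [Function.iterate_succ_apply']; nlinarith
    have hlt : (C (a.coeff 0) * x).degree < (carlitzDefTheta R q f
        (aeval (carlitzDefTheta R q f) a.divX x)).degree := by
      apply degree_lt_degree
      rw [j1, i1]
      refine lt_of_le_of_lt (natDegree_C_mul_le _ _) ?_
      have := hge m x.natDegree
      nlinarith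
    have lc : (aeval (carlitzDefTheta R q f) a x).leadingCoeff =
      a.leadingCoeff * f.leadingCoeff ^ (m+1) * x.leadingCoeff := by
      rw [key, leadingCoeff_add_of_degree_lt' hlt, j2, i2]
      have : a.divX.leadingCoeff = a.leadingCoeff := by
        rw [leadingCoeff, leadingCoeff, hd, hm, coeff_divX]
      rw [this]; ring
    refine ⟨?_, ?_, lc⟩
    · rw [← leadingCoeff_ne_zero, lc]
      simp [ha, hx, hf0]
    · rw [key, natDegree_add_eq_left_of_degree_lt hlt, j1, i1, Function.iterate_succ_apply']

lemma cdt_cancel (hq : 2 ≤ q) (hf : 2 ≤ f.natDegree) {a x y : R[X]} (ha : a ≠ 0)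
    (h : aeval (carlitzDefTheta R q f) a x = aeval (carlitzDefTheta R q f) a y) : x = y := by
  by_contra hne
  exact (cdt_aeval_deg hq hf _ ha rfl (sub_ne_zero.2 hne)).1 (by rw [map_sub, h, sub_self])

lemma iter_inj {n q : ℕ} (hq : 2 ≤ q) {m m' d d' : ℕ} (hd : ∀ e, d ≠ n + q * e)
    (hd' : ∀ e, d' ≠ n + q * e)
    (h : (fun e => n + q * e)^[m] d = (fun e => n + q * e)^[m'] d') : d = d' := by
  induction m generalizing m' with
  | zero =>
    cases m' with
    | zero => simpa using h
    | succ m' => rw [Function.iterate_succ_apply'] at h; exact absurd h (hd _)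
  | succ m ih =>
    cases m' with
    | zero => rw [Function.iterate_succ_apply'] at h; exact absurd h.symm (hd' _)
    | succ m' =>
      rw [Function.iterate_succ_apply', Function.iterate_succ_apply'] at h
      apply ih (m' := m')
      have : q * (fun e => n + q * e)^[m] d = q * (fun e => n + q * e)^[m'] d' := by
        simpa using h
      exact Nat.eq_of_mul_eq_mul_left (by omega) this

theorem cdt_basis (hq : 2 ≤ q) (hf : 2 ≤ f.natDegree) (hlf : IsUnit f.leadingCoeff) :
    Nonempty (Module.Basis {d : ℕ // ∀ e, d ≠ f.natDegree + q * e} R[X]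
      (Module.AEval' (carlitzDefTheta R q f))) := by
  set φ := carlitzDefTheta R q f with hφ
  let v : {d : ℕ // ∀ e, d ≠ f.natDegree + q * e} → Module.AEval' φ :=
    fun d => Module.AEval'.of φ (X ^ d.1)
  have hsm : ∀ (a x : R[X]), a • Module.AEval'.of φ x = Module.AEval'.of φ (aeval φ a x) := by
    intro a x; exact (Module.AEval.of_aeval_smul ..).symm
  refine ⟨Module.Basis.mk (v := v) ?_ ?_⟩
  · rw [linearIndependent_iff']
    intro s g hg
    by_contra hcon
    push Not at hcon
    have h1 : ∑ i ∈ s, aeval φ (g i) (X ^ i.1) = 0 := by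
      apply (Module.AEval'.of φ).injective
      rw [map_sum, map_zero, ← hg]
      exact Finset.sum_congr rfl fun i _ => (hsm _ _).symm
    have h2 := Polynomial.degree_sum_eq_of_disjoint (fun i => aeval φ (g i) (X ^ i.1)) s ?_
    · rw [h1, degree_zero] at h2
      obtain ⟨i, hi, hgi⟩ := hcon
      have := Finset.le_sup (f := fun i => (aeval φ (g i) (X ^ i.1)).degree) hi
      have h3 : (aeval φ (g i) (X ^ i.1)).degree ≤ ⊥ := by rw [h2]; exact this
      rw [le_bot_iff, degree_eq_bot] at h3
      exact (cdt_aeval_deg hq hf _ hgi rfl (by simp)).1 h3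
    · rintro i ⟨_, hi⟩ j ⟨_, hj⟩ hij heq
      apply hij
      have hgi : g i ≠ 0 := fun h => hi (by simp [h])
      have hgj : g j ≠ 0 := fun h => hj (by simp [h])
      have ai := (cdt_aeval_deg (q := q) (f := f) hq hf _ hgi rfl (x := X ^ i.1) (by simp)).2.1
      have aj := (cdt_aeval_deg (q := q) (f := f) hq hf _ hgj rfl (x := X ^ j.1) (by simp)).2.1
      have := natDegree_eq_of_degree_eq heq
      rw [← hφ] at ai aj
      rw [ai, aj, natDegree_X_pow, natDegree_X_pow] at this
      exact Subtype.ext (iter_inj hq i.2 j.2 this)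
  · rintro w -
    obtain ⟨x, rfl⟩ := (Module.AEval'.of φ).surjective w
    set W := Submodule.span R[X] (Set.range v)
    induction hD : x.natDegree using Nat.strong_induction_on generalizing x with
    | _ D ih =>
    have hX : Module.AEval'.of φ (X ^ D) ∈ W ∨ ∃ y : R[X], Module.AEval'.of φ y ∈ W ∧ 
        y.natDegree = D ∧ IsUnit y.leadingCoeff := by
      by_cases hS : ∀ e, D ≠ f.natDegree + q * e
      · left
        exact Submodule.subset_span ⟨⟨D, hS⟩, rfl⟩
      · right
        push Not at hS
        obtain ⟨e, he⟩ := hS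
        have hX0 : (X ^ e : R[X]) ≠ 0 := by simp
        obtain ⟨d1, d2⟩ := cdt_deg (q := q) (f := f) hq hf hX0
        refine ⟨φ (X ^ e), ?_, ?_, ?_⟩
        · have := W.smul_mem (X : R[X]) (ih e (by nlinarith) (X ^ e) (by simp))
          rw [hsm] at this
          simpa using this
        · rw [d1, he]; simp
        · rw [d2]; simpa using hlf
    have hX' : ∃ y : R[X], Module.AEval'.of φ y ∈ W ∧ 
        y.natDegree = D ∧ IsUnit y.leadingCoeff := by
      rcases hX with h | h
      · exact ⟨_, h, by simp, by simp⟩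
      · exact h
    obtain ⟨y, hyW, hyD, c, hc⟩ := hX'
    have hcc : Module.AEval'.of φ (C (x.leadingCoeff * (c⁻¹ : Rˣ)) * y) ∈ W := by
      have := W.smul_mem (C (x.leadingCoeff * (c⁻¹ : Rˣ)) : R[X]) hyW
      rw [hsm, aeval_C, Module.algebraMap_end_apply, smul_eq_C_mul] at this
      exact this
    have hsub : Module.AEval'.of φ (x - C (x.leadingCoeff * (c⁻¹ : Rˣ)) * y) ∈ W := by
      by_cases hx0 : x = 0
      · subst hx0; simp
      by_cases hD0 : D = 0
      · obtain ⟨x0, rfl⟩ := natDegree_eq_zero.1 (hD.trans hD0)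
        obtain ⟨y0, rfl⟩ := natDegree_eq_zero.1 (hyD.trans hD0)
        have : (C x0 - C ((C x0).leadingCoeff * (c⁻¹ : Rˣ)) * C y0) = 0 := by
          rw [← C_mul, ← C_sub]
          rw [leadingCoeff_C] at hc ⊢
          rw [← hc]; simp
        rw [this, map_zero]; exact W.zero_mem
      · refine ih _ ?_ _ rfl
        have hu : IsUnit (x.leadingCoeff * (c⁻¹ : Rˣ)) ∨ True := Or.inr trivial
        have hne : x.leadingCoeff * ((c⁻¹ : Rˣ) : R) ≠ 0 :=
          mul_ne_zero (leadingCoeff_ne_zero.2 hx0) (Units.ne_zero _)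
        have hy0 : y ≠ 0 := by rintro rfl; simp at hc
        have hnd : (C (x.leadingCoeff * (c⁻¹ : Rˣ)) * y).natDegree = D := by
          rw [natDegree_C_mul hne, hyD]
        have hlt := degree_sub_lt_left (p := x) (q := C (x.leadingCoeff * (c⁻¹ : Rˣ)) * y) ?_ hx0 ?_
        · by_cases hz : x - C (x.leadingCoeff * (c⁻¹ : Rˣ)) * y = 0
          · rw [hz, natDegree_zero]; omega
          · rw [← hD]; exact natDegree_lt_natDegree hz hlt
        · rw [degree_eq_natDegree hx0, degree_eq_natDegree (mul_ne_zero (by simpa using hne) hy0),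
            hnd, hD]
        · rw [leadingCoeff_mul, leadingCoeff_C, ← hc, mul_assoc]; simp
    have := W.add_mem hsub hcc
    rw [← map_add, sub_add_cancel] at this
    exact this

theorem cdt_key [DecompositionMonoid R[X]] (hq : 2 ≤ q) (hf : 2 ≤ f.natDegree)
    (hlf : IsUnit f.leadingCoeff) {a c b u : R[X]} (hac : IsRelPrime a c)
    (h : aeval (carlitzDefTheta R q f) a b = aeval (carlitzDefTheta R q f) c u) :
    ∃ v, u = aeval (carlitzDefTheta R q f) a v := by
  obtain ⟨B⟩ := cdt_basis (q := q) (f := f) hq hf hlf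
  set φ := carlitzDefTheta R q f with hφ
  have hsm : ∀ (a x : R[X]), a • Module.AEval'.of φ x = Module.AEval'.of φ (aeval φ a x) := by
    intro a x; exact (Module.AEval.of_aeval_smul ..).symm
  have h1 : a • Module.AEval'.of φ b = c • Module.AEval'.of φ u := by
    rw [hsm, hsm, h]
  have h2 : ∀ s, a ∣ B.repr (Module.AEval'.of φ u) s := by
    intro s
    have := congrArg (fun w => B.repr w s) h1
    simp only [map_smul, Finsupp.smul_apply, smul_eq_mul] at this
    exact hac.dvd_of_dvd_mul_left ⟨_, this.symm⟩
  choose w hw using h2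
  obtain ⟨v, hv⟩ := (Module.AEval'.of φ).surjective
    (∑ s ∈ (B.repr (Module.AEval'.of φ u)).support, w s • B s)
  refine ⟨v, (Module.AEval'.of φ).injective ?_⟩
  rw [← hsm, hv, Finset.smul_sum]
  conv_lhs => rw [← B.linearCombination_repr (Module.AEval'.of φ u), Finsupp.linearCombination_apply,
    Finsupp.sum]
  exact Finset.sum_congr rfl fun s _ => by rw [smul_smul, ← hw]

end PartA

section PartB

variable {Fq : Type*} [Field Fq] [Fintype Fq] {E : Type*} [Field E] [Algebra Fq E]

lemma cw_ext {d : ℕ} (p : MvPolynomial (Fin d) E)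
    (h : p.totalDegree < (Fintype.card Fq - 1) * d) :
    ∑ y : Fin d → Fq, MvPolynomial.eval (fun i => algebraMap Fq E (y i)) p = 0 := by
  simp only [MvPolynomial.eval_eq']
  rw [Finset.sum_comm]
  refine Finset.sum_eq_zero fun e he => ?_
  rw [← Finset.mul_sum]
  have h1 : (MvPolynomial.monomial e (1 : Fq)).totalDegree < (Fintype.card Fq - 1) *
      Fintype.card (Fin d) := by
    rw [MvPolynomial.totalDegree_monomial _ one_ne_zero, Fintype.card_fin]
    exact lt_of_le_of_lt (MvPolynomial.le_totalDegree he) h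
  have h2 := MvPolynomial.sum_eval_eq_zero _ h1
  have h3 := congrArg (algebraMap Fq E) h2
  simp only [MvPolynomial.eval_monomial, one_mul, map_sum, map_zero, Finsupp.prod_fintype,
    pow_zero, implies_true, map_prod, map_pow] at h3
  rw [h3, mul_zero]

/-- The monic polynomial of degree `d` with lower coefficients `y`. -/
noncomputable def monicOf (d : ℕ) (y : Fin d → Fq) : Fq[X] :=
  X ^ d + ∑ i : Fin d, C (y i) * X ^ (i : ℕ)

omit [Fintype Fq] in
lemma monicOf_lt (d : ℕ) (y : Fin d → Fq) :
    (∑ i : Fin d, C (y i) * X ^ (i : ℕ)).degree < (d : WithBot ℕ) := by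
  refine lt_of_le_of_lt (degree_sum_le _ _) ?_
  rw [Finset.sup_lt_iff (by exact_mod_cast WithBot.bot_lt_coe d)]
  intro i _
  refine lt_of_le_of_lt (degree_C_mul_X_pow_le _ _) ?_
  exact_mod_cast i.2

omit [Fintype Fq] in
lemma monicOf_monic (d : ℕ) (y : Fin d → Fq) : (monicOf d y).Monic :=
  monic_X_pow_add (monicOf_lt d y)

omit [Fintype Fq] in
lemma monicOf_natDegree (d : ℕ) (y : Fin d → Fq) : (monicOf d y).natDegree = d := by
  rw [monicOf, natDegree_add_eq_left_of_degree_lt, natDegree_X_pow]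
  rw [degree_X_pow]; exact monicOf_lt d y

omit [Fintype Fq] in
lemma monicOf_cons (d : ℕ) (c : Fq) (y : Fin d → Fq) :
    monicOf (d + 1) (Fin.cons c y) = X * monicOf d y + C c := by
  simp only [monicOf, Fin.sum_univ_succ, Fin.cons_zero, Fin.cons_succ, Fin.val_zero, pow_zero,
    mul_one, Fin.val_succ, mul_add, Finset.mul_sum]
  rw [Finset.sum_congr rfl (fun (i : Fin d) _ => (by ring :
    C (y i) * X ^ ((i : ℕ) + 1) = X * (C (y i) * X ^ (i : ℕ))))]
  ring

omit [Fintype Fq] in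
lemma monicOf_coeff (d : ℕ) (y : Fin d → Fq) (i : Fin d) : (monicOf d y).coeff i = y i := by
  have : (i : ℕ) ≠ d := i.2.ne
  simp only [monicOf, coeff_add, coeff_X_pow, this, if_false, zero_add, finsetSum_coeff,
    coeff_C_mul]
  rw [Finset.sum_eq_single i]
  · simp
  · intro j _ hj
    have : (i : ℕ) ≠ j := fun h => hj (Fin.ext h.symm)
    simp [this]
  · simp

omit [Fintype Fq] in
lemma monicOf_inj (d : ℕ) : Function.Injective (monicOf (Fq := Fq) d) := by
  intro y z h
  funext i
  rw [← monicOf_coeff d y i, h, monicOf_coeff]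

omit [Fintype Fq] in
lemma monicOf_surj {a : Fq[X]} (ha : a.Monic) :
    a = monicOf a.natDegree (fun i => a.coeff i) := by
  conv_lhs => rw [ha.as_sum]
  rw [monicOf, ← Fin.sum_univ_eq_sum_range (fun i => C (a.coeff i) * X ^ i)]

lemma aeval_frob (x : E) (a : Fq[X]) (i : ℕ) :
    aeval x a ^ Fintype.card Fq ^ i = aeval (x ^ Fintype.card Fq ^ i) a := by
  induction i with
  | zero => simp
  | succ i ih =>
    rw [pow_succ, pow_mul, ih, pow_mul]
    generalize x ^ Fintype.card Fq ^ i = z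
    rw [← map_pow, ← FiniteField.expand_card, expand_aeval]

lemma frob_sum {ι : Type*} (s : Finset ι) (g : ι → E) (i : ℕ) :
    (∑ x ∈ s, g x) ^ Fintype.card Fq ^ i = ∑ x ∈ s, g x ^ Fintype.card Fq ^ i := by
  obtain ⟨p, hp⟩ := CharP.exists Fq
  obtain ⟨m, hpp, hm⟩ := FiniteField.card Fq p
  have : Fact p.Prime := ⟨hpp⟩
  have : CharP E p := charP_of_injective_algebraMap (algebraMap Fq E).injective p
  rw [hm, ← pow_mul]
  exact sum_pow_char_pow _ _ _ _

lemma sub_frob (x y : E) (i : ℕ) :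
    (x - y) ^ Fintype.card Fq ^ i = x ^ Fintype.card Fq ^ i - y ^ Fintype.card Fq ^ i := by
  obtain ⟨p, hp⟩ := CharP.exists Fq
  obtain ⟨m, hpp, hm⟩ := FiniteField.card Fq p
  have : Fact p.Prime := ⟨hpp⟩
  have : CharP E p := charP_of_injective_algebraMap (algebraMap Fq E).injective p
  rw [hm, ← pow_mul]
  exact sub_pow_char_pow ..

/-- The sum `∑ a(0)^m / a(θ)` over monic `a` of degree `d`. -/
noncomputable def Hsum (Fq : Type*) [Field Fq] [Fintype Fq] {E : Type*} [Field E] [Algebra Fq E]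
    (θ : E) (m d : ℕ) : E :=
  ∑ y : Fin d → Fq, aeval (0 : E) (monicOf d y) ^ m / aeval θ (monicOf d y)

/-- `∏_{k<d} (-θ^{q^k})`. -/
noncomputable def bz (q : ℕ) (θ : E) (d : ℕ) : E := ∏ k ∈ Finset.range d, (- θ ^ q ^ k)

lemma cw_app (θ : E) {k d m : ℕ} (hk : k < d) (hm : m < Fintype.card Fq - 1) :
    ∑ y : Fin d → Fq, aeval θ (monicOf d y) ^ (Fintype.card Fq ^ k - 1) *
      aeval (0 : E) (monicOf d y) ^ m = 0 := by
  classical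
  set q := Fintype.card Fq with hq
  have hq1 : 1 < q := Fintype.one_lt_card
  let ℓ : E → MvPolynomial (Fin d) E := fun x =>
    MvPolynomial.C (x ^ d) + ∑ i : Fin d, MvPolynomial.C (x ^ (i : ℕ)) * MvPolynomial.X i
  have hℓ : ∀ x y, MvPolynomial.eval (fun i => algebraMap Fq E (y i)) (ℓ x) =
      aeval x (monicOf d y) := by
    intro x y
    simp only [ℓ, monicOf, map_add, map_sum, map_mul, map_pow, aeval_X, aeval_C,
      MvPolynomial.eval_C, MvPolynomial.eval_X]
    congr 1
    exact Finset.sum_congr rfl fun i _ => mul_comm _ _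
  have hdeg : ∀ x, (ℓ x).totalDegree ≤ 1 := by
    intro x
    refine (MvPolynomial.totalDegree_add _ _).trans (max_le (by rw [MvPolynomial.totalDegree_C]; omega) ?_)
    refine MvPolynomial.totalDegree_finsetSum_le fun i _ => ?_
    refine (MvPolynomial.totalDegree_mul _ _).trans ?_
    rw [MvPolynomial.totalDegree_C, MvPolynomial.totalDegree_X]
  have h := cw_ext (Fq := Fq) ((∏ i ∈ Finset.range k, ℓ (θ ^ q ^ i) ^ (q - 1)) * ℓ 0 ^ m) ?_
  · refine Eq.trans ?_ h
    refine Finset.sum_congr rfl fun y _ => ?_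
    simp only [map_mul, map_pow, map_prod, hℓ]
    congr 1
    simp only [← aeval_frob, hq, ← pow_mul]
    rw [Finset.prod_pow_eq_pow_sum, ← Finset.sum_mul, ← hq, Nat.geomSum_eq (by omega),
      Nat.div_mul_cancel (Nat.sub_one_dvd_pow_sub_one _ _)]
  · have h1 : (∏ i ∈ Finset.range k, ℓ (θ ^ q ^ i) ^ (q - 1)).totalDegree ≤ k * (q - 1) := by
      refine (MvPolynomial.totalDegree_finsetProd _ _).trans ?_
      refine (Finset.sum_le_card_nsmul _ _ (q - 1) fun i _ => ?_).trans (by simp)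
      refine (MvPolynomial.totalDegree_pow _ _).trans ?_
      have := hdeg (θ ^ q ^ i)
      nlinarith
    have h2 : (ℓ 0 ^ m).totalDegree ≤ m := by
      refine (MvPolynomial.totalDegree_pow _ _).trans ?_
      have := hdeg 0
      nlinarith
    refine lt_of_le_of_lt (MvPolynomial.totalDegree_mul _ _) ?_
    have h3 : (k + 1) * (q - 1) ≤ d * (q - 1) := Nat.mul_le_mul_right _ hk
    rw [mul_comm (q - 1) d]
    nlinarith

variable {θ : E} (hθ : ∀ a : Fq[X], a ≠ 0 → aeval θ a ≠ 0)
include hθ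

omit [Fintype Fq] in
lemma theta_pow_inj {i j : ℕ} (h : θ ^ i = θ ^ j) : i = j := by
  by_contra hij
  have : (X ^ i - X ^ j : Fq[X]) ≠ 0 := by
    intro h0
    have := congrArg natDegree (sub_eq_zero.1 h0)
    simp at this; exact hij this
  exact hθ _ this (by simp [h])

lemma Hsum_succ {m d : ℕ} (hm : m < Fintype.card Fq - 1) :
    Hsum Fq θ (m + 1) d = bz (Fintype.card Fq) θ d * Hsum Fq θ m d := by
  set q := Fintype.card Fq with hq
  have hq1 : 1 < q := Fintype.one_lt_card
  let w : (Fin d → Fq) → E := fun y => aeval (0 : E) (monicOf d y) ^ m / aeval θ (monicOf d y)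
  let P : E[X] := ∑ y : Fin d → Fq, C (w y) * (monicOf d y).map (algebraMap Fq E)
  let B : E[X] := ∏ k ∈ Finset.range d, (X - C (θ ^ q ^ k))
  have hBm : B.Monic := monic_prod_of_monic _ _ fun k _ => monic_X_sub_C _
  have hBd : B.natDegree = d := by
    rw [natDegree_prod_of_monic _ _ fun k _ => monic_X_sub_C _]; simp only [natDegree_X_sub_C, Finset.sum_const, Finset.card_range, smul_eq_mul, mul_one]
  have hPB : P = C (Hsum Fq θ m d) * B := by
    rw [← sub_eq_zero]
    have hsub : P - C (Hsum Fq θ m d) * B =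
        ∑ y : Fin d → Fq, C (w y) * ((monicOf d y).map (algebraMap Fq E) - B) := by
      simp only [P, Hsum, map_sum, Finset.sum_mul, mul_sub, Finset.sum_sub_distrib, w]
    refine Polynomial.eq_zero_of_degree_lt_of_eval_index_eq_zero (s := Finset.range d)
      (v := fun k => θ ^ q ^ k) ?_ ?_ ?_
    · intro i _ j _ hij
      exact Nat.pow_right_injective hq1 (theta_pow_inj hθ hij)
    · rw [hsub, Finset.card_range]
      refine lt_of_le_of_lt (degree_sum_le _ _) ?_
      rw [Finset.sup_lt_iff (by exact_mod_cast WithBot.bot_lt_coe d)]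
      intro y _
      rw [← smul_eq_C_mul]
      refine lt_of_le_of_lt (degree_smul_le _ _) ?_
      have hm1 := (monicOf_monic d y).map (algebraMap Fq E)
      have hm2 : ((monicOf d y).map (algebraMap Fq E)).natDegree = d := by
        rw [natDegree_map, monicOf_natDegree]
      have := degree_sub_lt_left (p := (monicOf d y).map (algebraMap Fq E)) (q := B) ?_
        hm1.ne_zero ?_
      · refine lt_of_lt_of_le this ?_
        rw [degree_eq_natDegree hm1.ne_zero, hm2]
      · rw [degree_eq_natDegree hm1.ne_zero, degree_eq_natDegree hBm.ne_zero, hm2, hBd]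
      · rw [hm1.leadingCoeff, hBm.leadingCoeff]
    · intro k hk
      have hB0 : B.eval (θ ^ q ^ k) = 0 := by
        rw [eval_prod]
        exact Finset.prod_eq_zero hk (by simp)
      rw [eval_sub, eval_mul, hB0, mul_zero, sub_zero]
      rw [← cw_app (Fq := Fq) θ (Finset.mem_range.1 hk) hm]
      simp only [P, eval_finsetSum, eval_mul, eval_C, eval_map_algebraMap]
      refine Finset.sum_congr rfl fun y _ => ?_
      have h0 := hθ _ (monicOf_monic d y).ne_zero
      have hqk : q ^ k = (q ^ k - 1) + 1 := by
        have : 0 < q ^ k := by positivity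
        omega
      rw [← aeval_frob, ← hq]
      simp only [w]
      rw [div_mul_eq_mul_div, div_eq_iff h0]
      conv_lhs => rw [hqk, pow_succ]
      ring
  have h0 := congrArg (eval 0) hPB
  simp only [P, B, eval_finsetSum, eval_mul, eval_C, eval_map_algebraMap, eval_prod, eval_sub,
    eval_X, zero_sub] at h0
  rw [Hsum, bz, mul_comm, ← h0]
  refine Finset.sum_congr rfl fun y _ => ?_
  simp only [w]; ring

lemma Hsum_eq {m d : ℕ} (hm : m ≤ Fintype.card Fq - 1) :
    Hsum Fq θ m d = bz (Fintype.card Fq) θ d ^ m * Hsum Fq θ 0 d := by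
  induction m with
  | zero => simp
  | succ m ih => rw [Hsum_succ hθ (by omega), ih (by omega)]; ring

omit hθ in
lemma neg_one_q : (-1 : E) ^ Fintype.card Fq = -1 := by
  have := congrArg (algebraMap Fq E) (FiniteField.pow_card (-1 : Fq))
  simpa using this

omit hθ in
lemma neg_one_q1 : (-1 : E) ^ (Fintype.card Fq - 1) = 1 := by
  have := congrArg (algebraMap Fq E)
    (FiniteField.pow_card_sub_one_eq_one (-1 : Fq) (by simp))
  simpa using this

omit hθ in
lemma theta_bz (d : ℕ) : θ * bz (Fintype.card Fq) θ d ^ (Fintype.card Fq - 1) =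
    θ ^ Fintype.card Fq ^ d := by
  have hq1 : 1 < Fintype.card Fq := Fintype.one_lt_card
  induction d with
  | zero => simp [bz]
  | succ d ih =>
    rw [bz, Finset.prod_range_succ, ← bz, mul_pow, ← mul_assoc, ih, neg_pow, neg_one_q1, one_mul,
      ← pow_mul, ← pow_add, pow_succ]
    congr 1
    obtain ⟨c, hc⟩ : ∃ c, Fintype.card Fq = c + 1 := ⟨Fintype.card Fq - 1, by omega⟩
    rw [hc]; simp; ring

omit hθ in
lemma bz_add (j d : ℕ) : bz (Fintype.card Fq) θ j * bz (Fintype.card Fq) θ d ^ Fintype.card Fq ^ j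
    = bz (Fintype.card Fq) θ (j + d) := by
  have hneg : (-1 : E) ^ Fintype.card Fq ^ j = -1 := by
    induction j with
    | zero => simp
    | succ j ih => rw [pow_succ, pow_mul, ih, neg_one_q]
  rw [bz, bz, bz, Finset.prod_range_add, ← Finset.prod_pow]
  congr 1
  refine Finset.prod_congr rfl fun k _ => ?_
  rw [neg_pow, hneg, neg_one_mul, ← pow_mul, ← pow_add, add_comm j k]

lemma theta_ne : θ ≠ 0 := by
  have := hθ X X_ne_zero
  simpa using this

lemma s_rec (d : ℕ) : Hsum Fq θ 0 (d + 1) * (θ - θ ^ Fintype.card Fq ^ (d + 1)) =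
    Hsum Fq θ 0 d := by
  have hq1 : 1 < Fintype.card Fq := Fintype.one_lt_card
  have hθ0 := theta_ne hθ
  have h1 : Hsum Fq θ (Fintype.card Fq - 1) (d + 1) = Hsum Fq θ 0 (d + 1) - Hsum Fq θ 0 d / θ := by
    have key : ∀ m, Hsum Fq θ m (d + 1) = ∑ c : Fq, ∑ y : Fin d → Fq,
        algebraMap Fq E c ^ m / (θ * aeval θ (monicOf d y) + algebraMap Fq E c) := by
      intro m
      rw [Hsum, ← (Fin.consEquiv (fun _ : Fin (d + 1) => Fq)).sum_comp, Fintype.sum_prod_type]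
      refine Finset.sum_congr rfl fun c _ => Finset.sum_congr rfl fun y _ => ?_
      simp [Fin.consEquiv, monicOf_cons]
    have h0 : Hsum Fq θ 0 d / θ = ∑ y : Fin d → Fq, 1 / (θ * aeval θ (monicOf d y)) := by
      rw [Hsum, Finset.sum_div]
      refine Finset.sum_congr rfl fun y _ => ?_
      rw [pow_zero, div_div, mul_comm]
    classical
    rw [key, key, eq_sub_iff_add_eq, h0,
      ← Finset.add_sum_erase _ _ (Finset.mem_univ (0 : Fq)),
      ← Finset.add_sum_erase (a := (0 : Fq)) Finset.univ (fun c => ∑ y : Fin d → Fq,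
        algebraMap Fq E c ^ 0 / (θ * aeval θ (monicOf d y) + algebraMap Fq E c))
        (Finset.mem_univ (0 : Fq))]
    have hne : Fintype.card Fq - 1 ≠ 0 := by omega
    simp only [map_zero, zero_pow hne, zero_div, Finset.sum_const_zero, zero_add, add_zero,
      pow_zero]
    rw [add_comm]
    congr 1
    refine Finset.sum_congr rfl fun c hc => Finset.sum_congr rfl fun y _ => ?_
    rw [← map_pow, FiniteField.pow_card_sub_one_eq_one c (Finset.ne_of_mem_erase hc), map_one]
  rw [Hsum_eq hθ le_rfl] at h1
  have h2 := theta_bz (Fq := Fq) (θ := θ) (d + 1)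
  rw [← h2]
  field_simp at h1
  linear_combination -h1

omit hθ in
lemma s_zero : Hsum Fq θ 0 0 = 1 := by
  simp [Hsum, monicOf]

variable {D : ℕ → Fq[X]} (hD0 : D 0 = 1)
    (hD : ∀ i : ℕ, D (i + 1) =
      (X ^ Fintype.card Fq ^ (i + 1) - X) * (D i) ^ Fintype.card Fq)

/-- Coefficients of `C_{θ^k}`. -/
noncomputable def Qco (D : ℕ → Fq[X]) (θ : E) (k N : ℕ) : E :=
  ∑ x ∈ Finset.HasAntidiagonal.antidiagonal N, (θ ^ k) ^ Fintype.card Fq ^ x.1 *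
    Hsum Fq θ 0 x.2 ^ Fintype.card Fq ^ x.1 / aeval θ (D x.1)

omit hθ in
include hD0 hD in
lemma D_monic (j : ℕ) : (D j).Monic := by
  have hq1 : 1 < Fintype.card Fq := Fintype.one_lt_card
  induction j with
  | zero => rw [hD0]; exact monic_one
  | succ j ih =>
    rw [hD]
    refine Monic.mul (monic_X_pow_sub ?_) (ih.pow _)
    rw [degree_X]
    exact_mod_cast Nat.one_lt_pow (by omega) hq1

include hD0 hD

lemma Q_succ_zero (k : ℕ) : Qco D θ (k + 1) 0 = θ * Qco D θ k 0 := by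
  simp [Qco, s_zero, hD0, pow_succ, mul_comm]

lemma Dinv (j : ℕ) : (θ ^ Fintype.card Fq ^ (j + 1) - θ) / aeval θ (D (j + 1)) =
    1 / aeval θ (D j) ^ Fintype.card Fq := by
  have h1 := hθ _ (D_monic hD0 hD (j + 1)).ne_zero
  have h2 := hθ _ (D_monic hD0 hD j).ne_zero
  rw [div_eq_div_iff h1 (pow_ne_zero _ h2), one_mul, hD]
  simp

lemma Q_aux (k N : ℕ) : ∑ x ∈ Finset.HasAntidiagonal.antidiagonal (N + 1), (θ ^ Fintype.card Fq ^ x.1 - θ) *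
    ((θ ^ k) ^ Fintype.card Fq ^ x.1 *
    Hsum Fq θ 0 x.2 ^ Fintype.card Fq ^ x.1 / aeval θ (D x.1)) =
    Qco D θ k N ^ Fintype.card Fq := by
  rw [Finset.Nat.antidiagonal_succ, Finset.sum_cons, Finset.sum_map]
  simp only [pow_zero, pow_one, sub_self, zero_mul, zero_add, Function.Embedding.prodMap,
    Function.Embedding.coeFn_mk, Prod.map, Function.Embedding.refl_apply, Nat.succ_eq_add_one]
  have := frob_sum (Fq := Fq) (Finset.HasAntidiagonal.antidiagonal N) (fun x => (θ ^ k) ^ Fintype.card Fq ^ x.1 *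
    Hsum Fq θ 0 x.2 ^ Fintype.card Fq ^ x.1 / aeval θ (D x.1)) 1
  rw [pow_one] at this
  rw [Qco, this]
  refine Finset.sum_congr rfl fun x _ => ?_
  have h := Dinv hθ hD0 hD x.1
  rw [div_pow, mul_pow, ← pow_mul, ← pow_mul _ (_ ^ _) (Fintype.card Fq), ← pow_succ]
  calc _ = (θ ^ k) ^ Fintype.card Fq ^ (x.1 + 1) * Hsum Fq θ 0 x.2 ^ Fintype.card Fq ^ (x.1 + 1) *
      ((θ ^ Fintype.card Fq ^ (x.1 + 1) - θ) / aeval θ (D (x.1 + 1))) := by ring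
    _ = _ := by rw [h]; ring

lemma Q_succ (k N : ℕ) : Qco D θ (k + 1) (N + 1) =
    θ * Qco D θ k (N + 1) + Qco D θ k N ^ Fintype.card Fq := by
  rw [← Q_aux hθ hD0 hD, Qco, Qco, Finset.mul_sum, ← Finset.sum_add_distrib]
  refine Finset.sum_congr rfl fun x _ => ?_
  rw [pow_succ θ k, mul_pow]; ring

lemma Q_zero_rec (N : ℕ) : (θ ^ Fintype.card Fq ^ (N + 1) - θ) * Qco D θ 0 (N + 1) =
    Qco D θ 0 N ^ Fintype.card Fq - Qco D θ 0 N := by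
  have h2 : ∑ x ∈ Finset.HasAntidiagonal.antidiagonal (N + 1),
      (θ ^ Fintype.card Fq ^ (N + 1) - θ ^ Fintype.card Fq ^ x.1) *
      ((θ ^ 0) ^ Fintype.card Fq ^ x.1 *
      Hsum Fq θ 0 x.2 ^ Fintype.card Fq ^ x.1 / aeval θ (D x.1)) = - Qco D θ 0 N := by
    rw [Finset.Nat.antidiagonal_succ', Finset.sum_cons, Finset.sum_map]
    simp only [sub_self, zero_mul, zero_add, Function.Embedding.prodMap,
      Function.Embedding.coeFn_mk, Prod.map, Function.Embedding.refl_apply, Nat.succ_eq_add_one]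
    rw [Qco, ← Finset.sum_neg_distrib]
    refine Finset.sum_congr rfl fun x hx => ?_
    rw [Finset.HasAntidiagonal.mem_antidiagonal] at hx
    have h3 := congrArg (fun z => z ^ Fintype.card Fq ^ x.1) (s_rec hθ x.2)
    simp only [mul_pow] at h3
    rw [sub_frob, ← pow_mul, ← pow_add] at h3
    have h4 : x.2 + 1 + x.1 = N + 1 := by omega
    rw [h4] at h3
    rw [← h3]; ring
  rw [← Q_aux hθ hD0 hD, sub_eq_add_neg _ (Qco D θ 0 N), ← h2, Qco, Finset.mul_sum, ← Finset.sum_add_distrib]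
  refine Finset.sum_congr rfl fun x _ => ?_
  ring

lemma Q_zero_zero : Qco D θ 0 0 = 1 := by
  simp [Qco, s_zero, hD0]

lemma Q_zero_succ (N : ℕ) : Qco D θ 0 (N + 1) = 0 := by
  have hq1 : 1 < Fintype.card Fq := Fintype.one_lt_card
  have hne : ∀ N, θ ^ Fintype.card Fq ^ (N + 1) - θ ≠ 0 := by
    intro N h
    have h1 : θ ^ Fintype.card Fq ^ (N + 1) = θ ^ 1 := by rw [pow_one]; exact sub_eq_zero.1 h
    have := theta_pow_inj hθ h1
    exact absurd this (Nat.one_lt_pow (by omega) hq1).ne'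
  induction N with
  | zero =>
    have := Q_zero_rec hθ hD0 hD 0
    rw [Q_zero_zero hθ hD0 hD, one_pow, sub_self] at this
    exact (mul_eq_zero.1 this).resolve_left (hne 0)
  | succ N ih =>
    have := Q_zero_rec hθ hD0 hD (N + 1)
    rw [ih, zero_pow (by omega), sub_self] at this
    exact (mul_eq_zero.1 this).resolve_left (hne _)

lemma Q_gt (k N : ℕ) (h : k < N) : Qco D θ k N = 0 := by
  have hq1 : 1 < Fintype.card Fq := Fintype.one_lt_card
  induction k generalizing N with
  | zero =>
    obtain ⟨N, rfl⟩ : ∃ M, N = M + 1 := ⟨N - 1, by omega⟩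
    exact Q_zero_succ hθ hD0 hD N
  | succ k ih =>
    obtain ⟨N, rfl⟩ : ∃ M, N = M + 1 := ⟨N - 1, by omega⟩
    rw [Q_succ hθ hD0 hD, ih _ (by omega), ih _ (by omega), zero_pow (by omega)]; simp

lemma U_eq (r k M : ℕ) (hM : k ≤ M) :
    ∑ N ∈ Finset.range (M + 1), bz (Fintype.card Fq) θ N ^ r * Qco D θ k N =
    aeval θ (((carlitzDefTheta Fq (Fintype.card Fq) ((-X) ^ r)) ^ k) 1) := by
  have hq1 : 1 < Fintype.card Fq := Fintype.one_lt_card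
  induction k generalizing M with
  | zero =>
    rw [Finset.sum_range_succ']
    simp [Q_zero_succ hθ hD0 hD, Q_zero_zero hθ hD0 hD, bz]
  | succ k ih =>
    obtain ⟨M, rfl⟩ : ∃ M', M = M' + 1 := ⟨M - 1, by omega⟩
    rw [pow_succ', Module.End.mul_apply, cdt_apply, map_add, map_mul, map_mul, aeval_X,
      ← expand_eq_comp_X_pow, FiniteField.expand_card, map_pow, map_pow, map_neg, aeval_X]
    nth_rw 1 [← ih M (by omega)]
    rw [← ih (M + 1) (by omega)]
    have := frob_sum (Fq := Fq) (Finset.range (M + 1))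
      (fun N => bz (Fintype.card Fq) θ N ^ r * Qco D θ k N) 1
    rw [pow_one] at this
    rw [this, Finset.sum_range_succ', Q_succ_zero hθ hD0 hD,
      Finset.sum_range_succ' (fun N => bz (Fintype.card Fq) θ N ^ r * Qco D θ k N) (M + 1)]
    simp only [Q_succ hθ hD0 hD, mul_add, Finset.sum_add_distrib, Finset.mul_sum]
    have hb : ∀ N, bz (Fintype.card Fq) θ (N + 1) =
        -θ * bz (Fintype.card Fq) θ N ^ Fintype.card Fq := by
      intro N
      rw [add_comm, ← bz_add]
      simp [bz]
    have e1 : ∑ N ∈ Finset.range (M + 1), bz (Fintype.card Fq) θ (N + 1) ^ r *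
        Qco D θ k N ^ Fintype.card Fq = ∑ N ∈ Finset.range (M + 1), (-θ) ^ r *
        (bz (Fintype.card Fq) θ N ^ r * Qco D θ k N) ^ Fintype.card Fq := by
      refine Finset.sum_congr rfl fun N _ => ?_
      rw [hb, mul_pow, mul_pow]; ring
    rw [← e1]
    have e2 : ∑ N ∈ Finset.range (M + 1), bz (Fintype.card Fq) θ (N + 1) ^ r *
        (θ * Qco D θ k (N + 1)) = ∑ N ∈ Finset.range (M + 1), θ *
        (bz (Fintype.card Fq) θ (N + 1) ^ r * Qco D θ k (N + 1)) := 
      Finset.sum_congr rfl fun N _ => by ring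
    rw [e2]; ring

theorem partB {n r k : ℕ} (hn : n = r + k * (Fintype.card Fq - 1)) (hr1 : 1 ≤ r)
    (hr : r ≤ Fintype.card Fq - 1)
    (g : ℕ → Fq[X] → E)
    (hg : ∀ j (a : Fq[X]), a.Monic → aeval θ (D j) * aeval θ a ^ Fintype.card Fq ^ j * g j a =
      bz (Fintype.card Fq) θ j ^ n * aeval (0 : E) a ^ n) (M : ℕ) (hM : k ≤ M) :
    θ ^ k * ∑ N ∈ Finset.range (M + 1), ∑ x ∈ Finset.HasAntidiagonal.antidiagonal N,
      ∑ y : Fin x.2 → Fq, g x.1 (monicOf x.2 y) =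
    aeval θ (((carlitzDefTheta Fq (Fintype.card Fq) ((-X) ^ r)) ^ k) 1) := by
  have hq1 : 1 < Fintype.card Fq := Fintype.one_lt_card
  rw [← U_eq hθ hD0 hD r k M hM, Finset.mul_sum]
  refine Finset.sum_congr rfl fun N _ => ?_
  rw [Qco, Finset.mul_sum, Finset.mul_sum]
  refine Finset.sum_congr rfl fun x hx => ?_
  rw [Finset.HasAntidiagonal.mem_antidiagonal] at hx
  set j := x.1
  set d := x.2
  have hDj := hθ _ (D_monic hD0 hD j).ne_zero
  have h1 : ∑ y : Fin d → Fq, g j (monicOf d y) =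
      bz (Fintype.card Fq) θ j ^ n / aeval θ (D j) * Hsum Fq θ r d ^ Fintype.card Fq ^ j := by
    rw [Hsum, frob_sum, Finset.mul_sum]
    refine Finset.sum_congr rfl fun y _ => ?_
    have ha := hθ _ (monicOf_monic d y).ne_zero
    have h := hg j _ (monicOf_monic d y)
    set c := (monicOf d y).coeff 0 with hc
    have h0 : aeval (0 : E) (monicOf d y) = algebraMap Fq E c := by
      rw [hc, coeff_zero_eq_aeval_zero, ← aeval_algebraMap_apply, map_zero]
    have h3 : c ^ n = (c ^ r) := by
      by_cases hc0 : c = 0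
      · rw [hc0, zero_pow (by omega), zero_pow (by omega)]
      · rw [hn, pow_add, mul_comm k, pow_mul, FiniteField.pow_card_sub_one_eq_one _ hc0, one_pow,
          mul_one]
    have h4 : (c ^ r) ^ Fintype.card Fq ^ j = c ^ r := FiniteField.pow_card_pow _ _
    rw [div_pow, h0, ← map_pow, ← map_pow, h4, div_mul_div_comm, eq_div_iff
      (mul_ne_zero hDj (pow_ne_zero _ ha)), mul_comm, h, h0, ← map_pow, h3]
  rw [h1, Hsum_eq hθ hr, mul_pow, ← hx, ← bz_add]
  have h5 : θ ^ k * bz (Fintype.card Fq) θ j ^ n = bz (Fintype.card Fq) θ j ^ r *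
      (θ ^ k) ^ Fintype.card Fq ^ j := by
    rw [← pow_mul, mul_comm k, pow_mul, ← theta_bz, mul_pow, hn, pow_add, mul_comm k, pow_mul]
    ring
  calc _ = (θ ^ k * bz (Fintype.card Fq) θ j ^ n) * (bz (Fintype.card Fq) θ d ^ r) ^
        Fintype.card Fq ^ j * Hsum Fq θ 0 d ^ Fintype.card Fq ^ j / aeval θ (D j) := by ring
    _ = _ := by rw [h5]; ring

end PartB

section PartC

variable {R : Type*} [CommRing R]

lemma algMap_laurent (r : R) : algebraMap R (LaurentSeries R) r = HahnSeries.C r := by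
  rw [HahnSeries.algebraMap_apply', PowerSeries.algebraMap_apply, Algebra.algebraMap_self_apply,
    HahnSeries.ofPowerSeries_C]
lemma algMap_laurent_mv {Fq : Type*} [Field Fq] (n : ℕ) (r : Fq) :
    algebraMap Fq (LaurentSeries (MvPolynomial (Fin n) Fq)) r =
      HahnSeries.C (algebraMap Fq (MvPolynomial (Fin n) Fq) r) := by
  rw [HahnSeries.algebraMap_apply', PowerSeries.algebraMap_apply, HahnSeries.ofPowerSeries_C]

/-- `θ` as a Laurent series in `1/θ`. -/
noncomputable def thL (R : Type*) [CommRing R] : LaurentSeries R := HahnSeries.single (-1 : ℤ) 1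

lemma thL_pow (i : ℕ) : thL R ^ i = HahnSeries.single (-(i : ℤ)) 1 := by
  rw [thL, HahnSeries.single_pow]; simp

lemma coeff_thL (p : R[X]) (g : ℤ) :
    (aeval (thL R) p).coeff g = if g ≤ 0 then p.coeff (-g).toNat else 0 := by
  induction p using Polynomial.induction_on' with
  | add p q hp hq => rw [map_add, HahnSeries.coeff_add, hp, hq]; split_ifs <;> simp
  | monomial i r =>
    rw [aeval_monomial, thL_pow, algMap_laurent,
      HahnSeries.C_apply, HahnSeries.single_mul_single, mul_one, zero_add, HahnSeries.coeff_single,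
      coeff_monomial]
    by_cases hg : g ≤ 0
    · rw [if_pos hg]
      have : g = -(i : ℤ) ↔ i = (-g).toNat := by omega
      simp only [this]
    · rw [if_neg hg, if_neg (by omega)]

lemma coeff_thL_neg (p : R[X]) (i : ℕ) : (aeval (thL R) p).coeff (-(i : ℤ)) = p.coeff i := by
  rw [coeff_thL, if_pos (by omega)]; simp

lemma thL_inj {p p' : R[X]} (h : aeval (thL R) p = aeval (thL R) p') : p = p' := by
  ext i
  rw [← coeff_thL_neg, h, coeff_thL_neg]

/-- `x` starts in degree `e` with coefficient `c`. -/
def LTm (x : LaurentSeries R) (e : ℤ) (c : R) : Prop :=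
  ∃ y : PowerSeries R, x = HahnSeries.single e 1 * HahnSeries.ofPowerSeries ℤ R y ∧
    PowerSeries.constantCoeff y = c

lemma ofPS_coeff (y : PowerSeries R) (g : ℤ) : (HahnSeries.ofPowerSeries ℤ R y).coeff g =
    if g < 0 then 0 else PowerSeries.coeff g.natAbs y := PowerSeries.coeff_coe ..

lemma LTm_iff {x : LaurentSeries R} {e : ℤ} {c : R} :
    LTm x e c ↔ x.coeff e = c ∧ ∀ g < e, x.coeff g = 0 := by
  constructor
  · rintro ⟨y, rfl, hy⟩
    constructor
    · rw [HahnSeries.coeff_single_mul, one_mul, ofPS_coeff]; simp [hy]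
    · intro g hg
      rw [HahnSeries.coeff_single_mul, one_mul, ofPS_coeff, if_pos (by omega)]
  · rintro ⟨h1, h2⟩
    refine ⟨PowerSeries.mk fun i => x.coeff (e + i), ?_, ?_⟩
    · ext g
      rw [HahnSeries.coeff_single_mul, one_mul, ofPS_coeff]
      split_ifs with h
      · exact h2 g (by omega)
      · rw [PowerSeries.coeff_mk]; congr 1; omega
    · simp [← PowerSeries.coeff_zero_eq_constantCoeff_apply, h1]

lemma LTm.mul {x y : LaurentSeries R} {e e' : ℤ} {c c' : R} (h : LTm x e c) (h' : LTm y e' c') :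
    LTm (x * y) (e + e') (c * c') := by
  obtain ⟨s, rfl, rfl⟩ := h
  obtain ⟨t, rfl, rfl⟩ := h'
  refine ⟨s * t, ?_, by simp⟩
  rw [map_mul, mul_mul_mul_comm, HahnSeries.single_mul_single, one_mul]

lemma LTm.one : LTm (1 : LaurentSeries R) 0 1 := ⟨1, by simp, by simp⟩

lemma LTm.pow {x : LaurentSeries R} {e : ℤ} {c : R} (h : LTm x e c) (m : ℕ) :
    LTm (x ^ m) (m * e) (c ^ m) := by
  induction m with
  | zero => simpa using LTm.one
  | succ m ih =>
    have := ih.mul h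
    rw [pow_succ, pow_succ]
    convert this using 1
    push_cast; ring

lemma LTm.prod {ι : Type*} (s : Finset ι) {x : ι → LaurentSeries R} {e : ι → ℤ} {c : ι → R}
    (h : ∀ i ∈ s, LTm (x i) (e i) (c i)) : LTm (∏ i ∈ s, x i) (∑ i ∈ s, e i) (∏ i ∈ s, c i) := by
  classical
  induction s using Finset.induction_on with
  | empty => simpa using LTm.one
  | insert a s ha ih =>
    rw [Finset.prod_insert ha, Finset.sum_insert ha, Finset.prod_insert ha]
    exact (h a (by simp)).mul (ih fun i hi => h i (by simp [hi]))

lemma LTm.inv {x : LaurentSeries R} {e : ℤ} (h : LTm x e 1) :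
    ∃ x' : LaurentSeries R, LTm x' (-e) 1 ∧ x' * x = 1 := by
  obtain ⟨s, rfl, hs⟩ := h
  refine ⟨HahnSeries.single (-e) 1 * HahnSeries.ofPowerSeries ℤ R (PowerSeries.invOfUnit s 1),
    ⟨_, rfl, by simp⟩, ?_⟩
  rw [mul_mul_mul_comm, HahnSeries.single_mul_single, one_mul, ← map_mul, mul_comm _ s,
    PowerSeries.mul_invOfUnit s 1 (by simpa using hs)]
  simp

lemma LTm.poly (p : R[X]) : LTm (aeval (thL R) p) (-(p.natDegree : ℤ)) p.leadingCoeff := by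
  rw [LTm_iff]
  refine ⟨coeff_thL_neg _ _, fun g hg => ?_⟩
  rw [coeff_thL, if_pos (by omega)]
  exact coeff_eq_zero_of_natDegree_lt (by omega)

/-- Coefficientwise map on Laurent series. -/
noncomputable def spHom {S : Type*} [CommRing S] (h : R →+* S) :
    LaurentSeries R →+* LaurentSeries S where
  toFun x := x.map h
  map_one' := by
    ext g
    simp only [HahnSeries.map_coeff, HahnSeries.coeff_one]; split_ifs <;> simp
  map_zero' := by ext g; simp
  map_add' x y := by ext g; simp
  map_mul' x y := HahnSeries.map_mul (h : R →ₙ+* S)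

lemma spHom_coeff {S : Type*} [CommRing S] (h : R →+* S) (x : LaurentSeries R) (g : ℤ) :
    (spHom h x).coeff g = h (x.coeff g) := rfl

lemma spHom_C {S : Type*} [CommRing S] (h : R →+* S) (r : R) :
    spHom h (HahnSeries.C r) = HahnSeries.C (h r) := by
  ext g
  simp only [spHom_coeff, HahnSeries.C_apply, HahnSeries.coeff_single]; split_ifs <;> simp

lemma spHom_thL {S : Type*} [CommRing S] (h : R →+* S) : spHom h (thL R) = thL S := by
  ext g
  simp only [spHom_coeff, thL, HahnSeries.coeff_single]; split_ifs <;> simp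

lemma spHom_aeval {S : Type*} [CommRing S] (h : R →+* S) (p : R[X]) :
    spHom h (aeval (thL R) p) = aeval (thL S) (p.map h) := by
  ext g
  rw [spHom_coeff, coeff_thL, coeff_thL]; split_ifs <;> simp

lemma min_unique {q n : ℕ} (hq : 2 ≤ q) (hn1 : ¬ n % (q - 1) = 1 % (q - 1)) (m : ℕ → ℤ)
    (hm : ∀ j, m (j + 1) - m j = (q : ℤ) ^ j * ((j : ℤ) * (q - 1) + q - n)) :
    ∃ J, ∀ j, j ≠ J → m J < m j := by
  have hex : ∃ j : ℕ, n < j * (q - 1) + q := by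
    refine ⟨n, ?_⟩
    have : n * 1 ≤ n * (q - 1) := Nat.mul_le_mul_left _ (by omega)
    omega
  classical
  have hJ := Nat.find_spec hex
  have hJ' := fun j => Nat.find_min hex (m := j)
  set J := Nat.find hex
  have hc : ∀ j : ℕ, ((j * (q - 1) + q : ℕ) : ℤ) = (j : ℤ) * (q - 1) + q := by
    intro j; rw [Nat.cast_add, Nat.cast_mul, Nat.cast_sub (by omega)]; simp
  have hqp : ∀ j : ℕ, (0 : ℤ) < (q : ℤ) ^ j := fun j => by positivity
  have up : ∀ j, J ≤ j → m j < m (j + 1) := by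
    intro j hj
    have h1 : n < j * (q - 1) + q := lt_of_lt_of_le hJ (by gcongr)
    have h2 : (0 : ℤ) < (j : ℤ) * (q - 1) + q - n := by rw [← hc]; omega
    have := mul_pos (hqp j) h2
    rw [← hm] at this; omega
  have down : ∀ j, j < J → m (j + 1) < m j := by
    intro j hj
    have h1 := hJ' j hj
    have hne : n ≠ j * (q - 1) + q := by
      intro h
      apply hn1
      rw [h, show j * (q - 1) + q = 1 + (q - 1) * (j + 1) by
        obtain ⟨c, rfl⟩ : ∃ c, q = c + 1 := ⟨q - 1, by omega⟩
        simp; ring]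
      simp
    have h2 : (0 : ℤ) < -((j : ℤ) * (q - 1) + q - n) := by rw [← hc]; omega
    have := mul_pos (hqp j) h2
    rw [mul_neg, ← hm] at this; omega
  refine ⟨J, fun j hj => ?_⟩
  rcases lt_or_gt_of_ne hj with h | h
  · obtain ⟨i, hi⟩ : ∃ i, J = j + 1 + i := ⟨J - j - 1, by omega⟩
    clear hj
    have : ∀ i, j + 1 + i ≤ J → m (j + 1 + i) < m j := by
      intro i
      induction i with
      | zero => intro _; exact down j h
      | succ i ih => intro h'; exact (down (j + 1 + i) (by omega)).trans (ih (by omega))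
    rw [hi]; exact this i hi.ge
  · obtain ⟨i, hi⟩ : ∃ i, j = J + 1 + i := ⟨j - J - 1, by omega⟩
    have : ∀ i, m J < m (J + 1 + i) := by
      intro i
      induction i with
      | zero => exact up J le_rfl
      | succ i ih => exact ih.trans (up (J + 1 + i) (by omega))
    rw [hi]; exact this i

end PartC

section PartD

variable {Fq : Type*} [Field Fq] [Fintype Fq] {n : ℕ}

lemma polyToTate_eq (a : Fq[X]) : polyToTate Fq n a =
    aeval (thL (MvPolynomial (Fin n) Fq)) (a.map (algebraMap Fq (MvPolynomial (Fin n) Fq))) := by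
  rw [polyToTate, show thetaTate Fq n = thL _ from rfl]
  induction a using Polynomial.induction_on' with
  | add p q hp hq => simp only [map_add, Polynomial.map_add, hp, hq]
  | monomial i r =>
    rw [map_monomial, aeval_monomial, aeval_monomial, algMap_laurent, algMap_laurent_mv]

lemma natDegree_D {D : ℕ → Fq[X]} (hD0 : D 0 = 1)
    (hD : ∀ i : ℕ, D (i + 1) =
      (X ^ Fintype.card Fq ^ (i + 1) - X) * (D i) ^ Fintype.card Fq) (j : ℕ) :
    (D j).natDegree = j * Fintype.card Fq ^ j := by
  have hq1 : 1 < Fintype.card Fq := Fintype.one_lt_card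
  induction j with
  | zero => simp [hD0]
  | succ j ih =>
    have hdl : (X : Fq[X]).degree < ((Fintype.card Fq ^ (j + 1) : ℕ) : WithBot ℕ) := by
      rw [degree_X]
      exact_mod_cast Nat.one_lt_pow (by omega) hq1
    have h1 : (X ^ Fintype.card Fq ^ (j + 1) - X : Fq[X]).Monic := monic_X_pow_sub hdl
    rw [hD, h1.natDegree_mul ((D_monic hD0 hD j).pow _), natDegree_pow, ih,
      natDegree_sub_eq_left_of_natDegree_lt, natDegree_X_pow]
    · ring
    · rw [natDegree_X, natDegree_X_pow]; exact Nat.one_lt_pow (by omega) hq1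

variable {D : ℕ → Fq[X]} (hD0 : D 0 = 1)
    (hD : ∀ i : ℕ, D (i + 1) =
      (X ^ Fintype.card Fq ^ (i + 1) - X) * (D i) ^ Fintype.card Fq)
    (G : HahnSeries.SummableFamily ℤ (MvPolynomial (Fin n) Fq) (ℕ × Fq[X]))
    (hG : ∀ (j : ℕ) (a : Fq[X]), a.Monic →
      polyToTate Fq n (D j) * (polyToTate Fq n a) ^ Fintype.card Fq ^ j * G (j, a) =
        tateBProd Fq n (Fintype.card Fq) j * tateAProd Fq n a)
    (hG' : ∀ (j : ℕ) (a : Fq[X]), ¬ a.Monic → G (j, a) = 0)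

include hD0 hD hG in
lemma LTm_G (j : ℕ) (a : Fq[X]) (ha : a.Monic) :
    LTm (G (j, a)) ((j * (Fintype.card Fq : ℤ) ^ j - n * ∑ k ∈ Finset.range j,
      (Fintype.card Fq : ℤ) ^ k) + (Fintype.card Fq : ℤ) ^ j * a.natDegree)
      (((-1) ^ j) ^ n * ∏ i : Fin n, aeval (MvPolynomial.X i) a) := by
  have hq1 : 1 < Fintype.card Fq := Fintype.one_lt_card
  have h1 : ∀ a : Fq[X], a.Monic → LTm (polyToTate Fq n a) (-(a.natDegree : ℤ)) 1 := by
    intro a ha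
    have := LTm.poly (a.map (algebraMap Fq (MvPolynomial (Fin n) Fq)))
    rw [ha.natDegree_map, (ha.map _).leadingCoeff] at this
    rwa [polyToTate_eq]
  have h2 := (h1 _ (D_monic hD0 hD j)).mul ((h1 a ha).pow (Fintype.card Fq ^ j))
  rw [one_pow, mul_one] at h2
  obtain ⟨x', hx', hxx⟩ := h2.inv
  have h3 : LTm (tateBProd Fq n (Fintype.card Fq) j) (∑ i : Fin n, ∑ k ∈ Finset.range j,
      (-((Fintype.card Fq ^ k : ℕ) : ℤ))) (∏ i : Fin n, ∏ k ∈ Finset.range j, (-1)) := by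
    refine LTm.prod _ fun i _ => LTm.prod _ fun k _ => ?_
    have hlt : (C (MvPolynomial.X i) : (MvPolynomial (Fin n) Fq)[X]).degree <
        (X ^ Fintype.card Fq ^ k : (MvPolynomial (Fin n) Fq)[X]).degree := by
      rw [degree_X_pow]
      exact lt_of_le_of_lt degree_C_le (by exact_mod_cast pow_pos (by omega) k)
    have := LTm.poly (C (MvPolynomial.X i) - X ^ Fintype.card Fq ^ k :
      (MvPolynomial (Fin n) Fq)[X])
    rw [natDegree_sub_eq_right_of_natDegree_lt (by
      rw [natDegree_C, natDegree_X_pow]; exact pow_pos (by omega) k), natDegree_X_pow,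
      leadingCoeff_sub_of_degree_lt' hlt, leadingCoeff_X_pow] at this
    convert this using 1
    rw [map_sub, aeval_C, map_pow, aeval_X, algMap_laurent]
    rfl
  have h4 : LTm (tateAProd Fq n a) (∑ i : Fin n, 0) (∏ i : Fin n, aeval (MvPolynomial.X i) a) := by
    refine LTm.prod _ fun i _ => ?_
    have := LTm.poly (C (aeval (MvPolynomial.X i) a) : (MvPolynomial (Fin n) Fq)[X])
    rw [aeval_C, leadingCoeff_C, natDegree_C] at this
    simpa [algMap_laurent] using this
  have h5 := hx'.mul (h3.mul h4)
  rw [← hG j a ha, ← mul_assoc, hxx, one_mul] at h5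
  convert h5 using 1
  · rw [natDegree_D hD0 hD]
    simp only [Finset.sum_const, Finset.card_univ, Fintype.card_fin, Finset.sum_neg_distrib]
    push_cast
    simp
    ring
  · simp

include hD0 hD hG hG' in
lemma lc_unit (hn1 : ¬ n % (Fintype.card Fq - 1) = 1 % (Fintype.card Fq - 1))
    (u : (MvPolynomial (Fin n) Fq)[X]) (hu : aeval (thetaTate Fq n) u = G.hsum) :
    IsUnit u.leadingCoeff := by
  have hq1 : 1 < Fintype.card Fq := Fintype.one_lt_card
  let m : ℕ → ℤ := fun j => j * (Fintype.card Fq : ℤ) ^ j - n * ∑ k ∈ Finset.range j,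
      (Fintype.card Fq : ℤ) ^ k
  obtain ⟨J, hJ⟩ := min_unique (q := Fintype.card Fq) hq1 hn1 m (by
    intro j
    simp only [m, Finset.sum_range_succ, pow_succ]
    push_cast; ring)
  have hJ1 := LTm_iff.1 (LTm_G hD0 hD G hG J 1 monic_one)
  have hother : ∀ x : ℕ × Fq[X], x ≠ (J, 1) → ∀ g ≤ m J, (G x).coeff g = 0 := by
    rintro ⟨j, a⟩ hx g hg
    by_cases ha : a.Monic
    · refine (LTm_iff.1 (LTm_G hD0 hD G hG j a ha)).2 g ?_
      refine lt_of_le_of_lt hg ?_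
      change m J < m j + _
      have hqp : (0 : ℤ) < (Fintype.card Fq : ℤ) ^ j := by positivity
      by_cases hj : j = J
      · subst hj
        have ha1 : a.natDegree ≠ 0 := by
          intro h
          exact hx (by rw [eq_one_of_monic_natDegree_zero ha h])
        have : (0 : ℤ) < a.natDegree := by omega
        have := mul_pos hqp this
        omega
      · have := hJ j hj
        have : (0 : ℤ) ≤ (Fintype.card Fq : ℤ) ^ j * a.natDegree := by positivity
        have := hJ j hj
        omega
    · rw [hG' j a ha]; simp
  have hlow : ∀ g < m J, G.hsum.coeff g = 0 := by
    intro g hg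
    rw [HahnSeries.SummableFamily.coeff_hsum]
    apply finsum_eq_zero_of_forall_eq_zero
    intro x
    by_cases hx : x = (J, 1)
    · rw [hx]; exact hJ1.2 g (by simpa [m] using hg)
    · exact hother x hx g hg.le
  have htop : G.hsum.coeff (m J) = ((-1) ^ J) ^ n := by
    rw [HahnSeries.SummableFamily.coeff_hsum, finsum_eq_single _ (J, 1)]
    · simpa [m] using hJ1.1
    · intro x hx; exact hother x hx _ le_rfl
  have hun : IsUnit (((-1) ^ J) ^ n : MvPolynomial (Fin n) Fq) := (isUnit_one.neg.pow _).pow _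
  rw [← hu, show thetaTate Fq n = thL _ from rfl] at htop hlow
  have hle : m J ≤ 0 := by
    by_contra h
    rw [coeff_thL, if_neg h] at htop
    rw [← htop] at hun; simp at hun
  obtain ⟨i, hi⟩ : ∃ i : ℕ, m J = -(i : ℤ) := ⟨(-(m J)).toNat, by omega⟩
  rw [hi, coeff_thL_neg] at htop
  have hnd : u.natDegree = i := by
    apply le_antisymm
    · rw [natDegree_le_iff_coeff_eq_zero]
      intro N hN
      rw [← coeff_thL_neg]
      exact hlow _ (by omega)
    · apply le_natDegree_of_ne_zero
      rw [htop]; exact hun.ne_zero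
  rw [leadingCoeff, hnd, htop]; exact hun

end PartD

section PartE

variable {Fq : Type*} [Field Fq] [Fintype Fq] {n : ℕ}

/-- Specialization `t₁ = ⋯ = t_n = 0`. -/
noncomputable def h0 (Fq : Type*) [Field Fq] (n : ℕ) : MvPolynomial (Fin n) Fq →+* Fq :=
  MvPolynomial.constantCoeff

lemma h0_X (i : Fin n) : h0 Fq n (MvPolynomial.X i) = 0 := MvPolynomial.constantCoeff_X Fq i

lemma h0_alg (r : Fq) : h0 Fq n (algebraMap Fq _ r) = r := by
  rw [MvPolynomial.algebraMap_eq]; exact MvPolynomial.constantCoeff_C _ r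

lemma h0_aeval (i : Fin n) (a : Fq[X]) :
    h0 Fq n (aeval (MvPolynomial.X i) a) = a.coeff 0 := by
  induction a using Polynomial.induction_on' with
  | add p q hp hq => rw [map_add, map_add, hp, hq, coeff_add]
  | monomial i r =>
    rw [aeval_monomial, map_mul, map_pow, h0_X, h0_alg, coeff_monomial]
    cases i <;> simp

lemma sp_poly (a : Fq[X]) : spHom (h0 Fq n) (polyToTate Fq n a) = aeval (thL Fq) a := by
  rw [polyToTate_eq, spHom_aeval, Polynomial.map_map]
  congr 1
  rw [show (h0 Fq n).comp (algebraMap Fq (MvPolynomial (Fin n) Fq)) = RingHom.id Fq from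
    RingHom.ext fun r => h0_alg r, Polynomial.map_id]

lemma sp_B (q j : ℕ) : spHom (h0 Fq n) (tateBProd Fq n q j) = bz q (thL Fq) j ^ n := by
  have : ∀ i : Fin n, ∏ k ∈ Finset.range j, (HahnSeries.C (h0 Fq n (MvPolynomial.X i)) -
      thL Fq ^ q ^ k) = bz q (thL Fq) j := by
    intro i
    rw [bz]
    refine Finset.prod_congr rfl fun k _ => ?_
    rw [h0_X, map_zero, zero_sub]
  simp only [tateBProd, map_prod, map_sub, map_pow, spHom_C,
    show thetaTate Fq n = thL _ from rfl, spHom_thL, this]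
  simp

lemma sp_A (a : Fq[X]) : spHom (h0 Fq n) (tateAProd Fq n a) =
    aeval (0 : LaurentSeries Fq) a ^ n := by
  have : aeval (0 : LaurentSeries Fq) a = HahnSeries.C (a.coeff 0) := by
    rw [← coeff_zero_eq_aeval_zero', algMap_laurent]
  simp only [tateAProd, map_prod, spHom_C, h0_aeval, this]
  simp

variable {D : ℕ → Fq[X]} (hD0 : D 0 = 1)
    (hD : ∀ i : ℕ, D (i + 1) =
      (X ^ Fintype.card Fq ^ (i + 1) - X) * (D i) ^ Fintype.card Fq)
    (G : HahnSeries.SummableFamily ℤ (MvPolynomial (Fin n) Fq) (ℕ × Fq[X]))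
    (hG : ∀ (j : ℕ) (a : Fq[X]), a.Monic →
      polyToTate Fq n (D j) * (polyToTate Fq n a) ^ Fintype.card Fq ^ j * G (j, a) =
        tateBProd Fq n (Fintype.card Fq) j * tateAProd Fq n a)
    (hG' : ∀ (j : ℕ) (a : Fq[X]), ¬ a.Monic → G (j, a) = 0)

lemma fin_sum_eq (M : ℕ) (e : ℤ)
    (hM : ∀ x : ℕ × Fq[X], (G x).coeff e ≠ 0 → x.2.Monic ∧ x.1 + x.2.natDegree ≤ M) :
    G.hsum.coeff e = ∑ N ∈ Finset.range (M + 1),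
      ∑ x ∈ Finset.HasAntidiagonal.antidiagonal N, ∑ y : Fin x.2 → Fq,
        (G (x.1, monicOf x.2 y)).coeff e := by
  classical
  let S : Finset (Σ _ : ℕ, Σ x : ℕ × ℕ, (Fin x.2 → Fq)) :=
    (Finset.range (M + 1)).sigma fun N =>
      (Finset.HasAntidiagonal.antidiagonal N).sigma fun x => Finset.univ
  let ι : (Σ _ : ℕ, Σ x : ℕ × ℕ, (Fin x.2 → Fq)) → ℕ × Fq[X] :=
    fun p => (p.2.1.1, monicOf p.2.1.2 p.2.2)
  have hinj : Set.InjOn ι S := by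
    rintro ⟨N, ⟨x1, x2⟩, y⟩ hp ⟨N', ⟨x1', x2'⟩, y'⟩ hp' h
    simp only [S, Finset.coe_sigma, Set.mem_sigma_iff, Finset.mem_coe, 
      Finset.HasAntidiagonal.mem_antidiagonal] at hp hp'
    simp only [ι, Prod.mk.injEq] at h
    obtain ⟨rfl, h2⟩ := h
    have h3 := congrArg natDegree h2
    rw [monicOf_natDegree, monicOf_natDegree] at h3
    subst h3
    have h4 := monicOf_inj _ h2
    subst h4
    have : N = N' := by rw [← hp.2.1, ← hp'.2.1]
    subst this
    rfl
  rw [HahnSeries.SummableFamily.coeff_hsum_eq_sum_of_subset (t := S.image ι), Finset.sum_image hinj]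
  · simp only [S, Finset.sum_sigma, ι]
  · intro x hx
    obtain ⟨h1, h2⟩ := hM x hx
    rw [Finset.coe_image]
    refine ⟨⟨x.1 + x.2.natDegree, ⟨(x.1, x.2.natDegree), fun i => x.2.coeff i⟩⟩, ?_, ?_⟩
    · simp only [S, Finset.coe_sigma, Set.mem_sigma_iff, Finset.mem_coe, 
        Finset.HasAntidiagonal.mem_antidiagonal, Finset.mem_range, Finset.mem_univ]
      exact ⟨by omega, trivial, trivial⟩
    · simp only [ι]
      rw [← monicOf_surj h1]

include hD0 hD hG hG' in
lemma spec_u {r k : ℕ} (hn : n = r + k * (Fintype.card Fq - 1)) (hr1 : 1 ≤ r)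
    (hr : r ≤ Fintype.card Fq - 1)
    (u : (MvPolynomial (Fin n) Fq)[X]) (hu : aeval (thetaTate Fq n) u = G.hsum) :
    X ^ k * u.map (h0 Fq n) =
      ((carlitzDefTheta Fq (Fintype.card Fq) ((-X) ^ r)) ^ k) 1 := by
  apply thL_inj
  have hθ : ∀ a : Fq[X], a ≠ 0 → aeval (thL Fq) a ≠ 0 := by
    intro a ha h
    exact ha (thL_inj (by rw [h, map_zero]))
  ext e
  obtain ⟨M, hM⟩ : ∃ M : ℕ, ∀ x : ℕ × Fq[X], (G x).coeff (e + k) ≠ 0 →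
      x.1 + x.2.natDegree ≤ M := by
    refine ⟨(G.finite_co_support (e + k)).toFinset.sup fun x => x.1 + x.2.natDegree, ?_⟩
    intro x hx
    exact Finset.le_sup (f := fun x : ℕ × Fq[X] => x.1 + x.2.natDegree) ((Set.Finite.mem_toFinset _).2 hx)
  have hB := partB hθ hD0 hD hn hr1 hr (fun j a => spHom (h0 Fq n) (G (j, a))) (by
    intro j a ha
    rw [← sp_B, ← sp_A, ← map_mul, ← hG j a ha, map_mul, map_mul, map_pow, sp_poly, sp_poly])
    (M + k) (by omega)
  rw [← hB, map_mul, map_pow, aeval_X, ← spHom_aeval, thL_pow, HahnSeries.coeff_single_mul,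
    HahnSeries.coeff_single_mul, one_mul, one_mul, spHom_coeff, sub_neg_eq_add,
    show thL (MvPolynomial (Fin n) Fq) = thetaTate Fq n from rfl, hu,
    fin_sum_eq G (M + k) (e + k)]
  · simp only [map_sum, HahnSeries.coeff_sum, spHom_coeff]
  · intro x hx
    refine ⟨?_, (hM x hx).trans (by omega)⟩
    by_contra hm
    exact hx (by rw [show x = (x.1, x.2) from rfl, hG' _ _ hm]; simp)

end PartE

section PartF

lemma map_cdt_pow {R S : Type*} [CommRing R] [IsDomain R] [CommRing S] [IsDomain S] (h : R →+* S)
    (q : ℕ) (f x : R[X]) (i : ℕ) : ((carlitzDefTheta R q f ^ i) x).map h =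
      (carlitzDefTheta S q (f.map h) ^ i) (x.map h) := by
  induction i with
  | zero => simp
  | succ i ih =>
    rw [pow_succ', pow_succ', Module.End.mul_apply, Module.End.mul_apply, ← ih, cdt_apply,
      cdt_apply]
    simp [Polynomial.map_comp]

lemma map_cdt {R S : Type*} [CommRing R] [IsDomain R] [CommRing S] [IsDomain S] (h : R →+* S)
    (q : ℕ) (f a x : R[X]) : (aeval (carlitzDefTheta R q f) a x).map h =
      aeval (carlitzDefTheta S q (f.map h)) (a.map h) (x.map h) := by
  induction a using Polynomial.induction_on' with
  | add a b ha hb =>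
    simp only [map_add, LinearMap.add_apply, Polynomial.map_add, ha, hb]
  | monomial i r =>
    rw [map_monomial, aeval_monomial, aeval_monomial, Module.End.mul_apply, Module.End.mul_apply,
      Module.algebraMap_end_apply, Module.algebraMap_end_apply, ← map_cdt_pow, Polynomial.map_smul]

variable {Fq : Type*} [Field Fq] [Fintype Fq]

lemma neg_X_pow_card : (-X : Fq[X]) ^ (Fintype.card Fq - 1) = X ^ (Fintype.card Fq - 1) := by
  have h1 : (-1 : Fq) ^ (Fintype.card Fq - 1) = 1 :=
    FiniteField.pow_card_sub_one_eq_one _ (neg_ne_zero.2 one_ne_zero)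
  have h2 : (-1 : Fq[X]) ^ (Fintype.card Fq - 1) = 1 := by
    have := congrArg (C : Fq → Fq[X]) h1
    simpa using this
  rw [neg_pow, h2, one_mul]

lemma conj_X {n r k : ℕ} (hn : n = r + k * (Fintype.card Fq - 1)) (a v : Fq[X]) :
    X ^ k * aeval (carlitzDefTheta Fq (Fintype.card Fq) ((-X) ^ n)) a v =
      aeval (carlitzDefTheta Fq (Fintype.card Fq) ((-X) ^ r)) a (X ^ k * v) := by
  have hq1 : 1 < Fintype.card Fq := Fintype.one_lt_card
  have hp : ∀ i v, X ^ k * (carlitzDefTheta Fq (Fintype.card Fq) ((-X) ^ n) ^ i) v =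
      (carlitzDefTheta Fq (Fintype.card Fq) ((-X) ^ r) ^ i) (X ^ k * v) := by
    intro i v
    induction i with
    | zero => simp
    | succ i ih =>
      rw [pow_succ', pow_succ', Module.End.mul_apply, Module.End.mul_apply, ← ih]
      generalize (carlitzDefTheta Fq (Fintype.card Fq) ((-X) ^ n) ^ i) v = w
      rw [cdt_apply, cdt_apply, mul_comp, X_pow_comp, hn, pow_add, mul_comm k, pow_mul,
        neg_X_pow_card]
      obtain ⟨p, hp⟩ : ∃ p, Fintype.card Fq = p + 1 := ⟨Fintype.card Fq - 1, by omega⟩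
      rw [hp]
      simp only [Nat.add_sub_cancel]
      ring
  induction a using Polynomial.induction_on' with
  | add a b ha hb =>
    simp only [map_add, LinearMap.add_apply, mul_add, ha, hb]
  | monomial i r =>
    rw [aeval_monomial, aeval_monomial, Module.End.mul_apply, Module.End.mul_apply,
      Module.algebraMap_end_apply, Module.algebraMap_end_apply, ← hp, mul_smul_comm]

omit [Fintype Fq] in
lemma pow_one_val {q r : ℕ} (hq : 2 ≤ q) (hr : 2 ≤ r) (i : ℕ) :
    ∃ z : Fq[X], (carlitzDefTheta Fq q ((-X) ^ r) ^ i) 1 = X ^ i * z ∧ z.coeff 0 = 1 := by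
  obtain ⟨s, rfl⟩ : ∃ s, r = s + 2 := ⟨r - 2, by omega⟩
  obtain ⟨p, rfl⟩ : ∃ p, q = p + 1 := ⟨q - 1, by omega⟩
  induction i with
  | zero => exact ⟨1, by simp, by simp⟩
  | succ i ih =>
    obtain ⟨z, hz, hz0⟩ := ih
    refine ⟨z + X * ((-1) ^ (s + 2) * X ^ s * X ^ (p * i) * z.comp (X ^ (p + 1))), ?_, ?_⟩
    · rw [pow_succ', Module.End.mul_apply, hz, cdt_apply, mul_comp, X_pow_comp, neg_pow (X : Fq[X])]
      ring
    · rw [coeff_add, hz0, mul_coeff_zero]; simp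

omit [Fintype Fq] in
lemma natDegree_negX (n : ℕ) : ((-X : Fq[X]) ^ n).natDegree = n := by
  rw [natDegree_pow, natDegree_neg, natDegree_X, mul_one]

omit [Fintype Fq] in
lemma unit_lc_negX (n : ℕ) : IsUnit ((-X : Fq[X]) ^ n).leadingCoeff := by
  rw [leadingCoeff_pow]; simp

lemma iter_ge {n q m d : ℕ} (hm : m ≠ 0) : n ≤ (fun e => n + q * e)^[m] d := by
  obtain ⟨i, rfl⟩ := Nat.exists_eq_succ_of_ne_zero hm
  rw [Function.iterate_succ_apply']; omega

lemma prim_Fq {n r k : ℕ} (hn : n = r + k * (Fintype.card Fq - 1)) (hr : 2 ≤ r)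
    {u0 a0 v0 : Fq[X]} (ha0 : a0 ≠ 0)
    (hu : X ^ k * u0 = ((carlitzDefTheta Fq (Fintype.card Fq) ((-X) ^ r)) ^ k) (1 : Fq[X]))
    (h : u0 = aeval (carlitzDefTheta Fq (Fintype.card Fq) ((-X) ^ n)) a0 v0) :
    a0.natDegree = 0 := by
  have hq1 : 2 ≤ Fintype.card Fq := Fintype.one_lt_card
  have hf : 2 ≤ ((-X : Fq[X]) ^ r).natDegree := by rwa [natDegree_negX]
  rw [h, conj_X hn] at hu
  set φ := carlitzDefTheta Fq (Fintype.card Fq) ((-X) ^ r) with hφ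
  obtain ⟨a', c', g, hrel, h1, h2⟩ :=
    UniqueFactorizationMonoid.exists_reduced_factors a0 ha0 (X ^ k : Fq[X])
  have hg0 : g ≠ 0 := by rintro rfl; simp at h1; exact ha0 h1.symm
  have hXk : (φ ^ k) (1 : Fq[X]) = aeval φ (X ^ k : Fq[X]) 1 := by rw [map_pow, aeval_X]
  generalize hw0 : X ^ k * v0 = w0 at hu
  rw [hXk, ← h1, ← h2, map_mul, map_mul, Module.End.mul_apply, Module.End.mul_apply] at hu
  have hu' := cdt_cancel hq1 hf hg0 hu
  obtain ⟨v', hv'⟩ := cdt_key hq1 hf (unit_lc_negX r) hrel hu'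
  have ha' : a' ≠ 0 := by rintro rfl; simp at hv'
  have hv0' : v' ≠ 0 := by rintro rfl; simp at hv'
  have hda : a'.natDegree = 0 := by
    by_contra hne
    have h3 := (cdt_aeval_deg hq1 hf _ ha' rfl hv0').2.1
    rw [← hφ, ← hv', natDegree_one] at h3
    have := iter_ge (n := ((-X : Fq[X]) ^ r).natDegree) (q := Fintype.card Fq)
      (d := v'.natDegree) hne
    omega
  obtain ⟨i, hik, hi⟩ := (dvd_prime_pow prime_X k).1 (⟨g, by rw [← h2, mul_comm]⟩ : c' ∣ (X : Fq[X]) ^ k)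
  obtain ⟨w, hw⟩ := hi.symm
  have ha'C : a' = C (a'.coeff 0) := eq_C_of_natDegree_eq_zero hda
  obtain ⟨y, hyu, hy⟩ := Polynomial.isUnit_iff.1 w.isUnit
  obtain ⟨z, hz, hz0⟩ := pow_one_val (Fq := Fq) hq1 hr i
  have hle : k ≤ i := by
    have h4 : aeval φ c' 1 = y • (X ^ i * z) := by
      rw [← hw, ← hy, mul_comm, map_mul, Module.End.mul_apply, aeval_C, map_pow, aeval_X, hz,
        Module.algebraMap_end_apply]
    rw [ha'C, aeval_C, Module.algebraMap_end_apply, h4] at hu'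
    by_contra hlt
    have h5 := congrArg (fun p : Fq[X] => p.coeff i) hu'
    simp only [coeff_smul] at h5
    rw [← hw0, coeff_X_pow_mul', coeff_X_pow_mul', if_neg hlt, if_pos le_rfl, Nat.sub_self, hz0] at h5
    simp at h5
    exact hyu.ne_zero h5.symm
  have hki : i = k := le_antisymm hik hle
  have hdeg : g.natDegree = 0 := by
    have h6 := congrArg natDegree h2
    have hc0 : c' ≠ 0 := by
      rintro rfl
      rw [mul_zero] at h2
      exact pow_ne_zero k X_ne_zero h2.symm
    rw [natDegree_mul hg0 hc0, natDegree_X_pow, ← hw, natDegree_mul (pow_ne_zero _ X_ne_zero)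
      w.ne_zero, natDegree_X_pow] at h6
    omega
  rw [← h1, natDegree_mul hg0 ha', hdeg, hda]

end PartF

section PartH

variable {Fq : Type*} [Field Fq] [Fintype Fq] {n : ℕ}

lemma f_facts {f : (MvPolynomial (Fin n) Fq)[X]}
    (hf : f = ∏ i : Fin n, (C (MvPolynomial.X i) - X)) :
    f.natDegree = n ∧ IsUnit f.leadingCoeff ∧ f.map (h0 Fq n) = (-X) ^ n := by
  have hX : ∀ i : Fin n, (C (MvPolynomial.X i) - X : (MvPolynomial (Fin n) Fq)[X]) =
      -(X - C (MvPolynomial.X i)) := fun i => by ring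
  have h1 : ∀ i : Fin n, (C (MvPolynomial.X i) - X : (MvPolynomial (Fin n) Fq)[X]).natDegree = 1 :=
    fun i => by rw [hX, natDegree_neg, natDegree_X_sub_C]
  have h2 : ∀ i : Fin n,
      (C (MvPolynomial.X i) - X : (MvPolynomial (Fin n) Fq)[X]).leadingCoeff = -1 :=
    fun i => by rw [hX, leadingCoeff_neg, leadingCoeff_X_sub_C]
  refine ⟨?_, ?_, ?_⟩
  · rw [hf, natDegree_prod]
    · simp [h1]
    · intro i _ h
      have := h1 i
      rw [h] at this; simp at this
  · rw [hf, leadingCoeff_prod]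
    simp only [h2]
    rw [Finset.prod_const]
    exact isUnit_one.neg.pow _
  · rw [hf, Polynomial.map_prod]
    simp only [Polynomial.map_sub, map_C, map_X, h0_X]
    simp

end PartH
/-- Let `n ≥ 1` with `n ≢ 1 (mod q−1)`, and `φ` the
canonical Carlitz deformation over `A[t₁,…,t_n]`.  Let
`𝓜(φ) = {φ_a(u) : a ∈ A[t₁,…,t_n]}` where
`u = u_C(t₁,…,t_n;1) = exp_φ(𝓛(φ/𝔸)) ∈ A[t₁,…,t_n]` (here `exp_φ(𝓛(φ/𝔸))`
is the sum of the summable family with terms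
`b_j(t₁)⋯b_j(t_n)·a(t₁)⋯a(t_n)/(D_j·a^{q^j})`, and `u` represents it).  Then
`𝓜(φ)` equals its radical: for every `b ∈ A[t₁,…,t_n]`, if `φ_a(b) ∈ 𝓜(φ)`
for some nonzero `a ∈ A[t₁,…,t_n]`, then `b ∈ 𝓜(φ)`. -/
theorem radical_of_M_eq_M_even_case
    (Fq : Type*) [Field Fq] [Fintype Fq]
    (q : ℕ) (hq : q = Fintype.card Fq)
    (n : ℕ) (hn : 1 ≤ n) (hn1 : ¬ n % (q - 1) = 1 % (q - 1))
    (D : ℕ → Polynomial Fq) (hD0 : D 0 = 1)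
    (hD : ∀ i : ℕ, D (i + 1) =
      (Polynomial.X ^ q ^ (i + 1) - Polynomial.X) * (D i) ^ q)
    (G : HahnSeries.SummableFamily ℤ (MvPolynomial (Fin n) Fq)
      (ℕ × Polynomial Fq))
    (hG : ∀ (j : ℕ) (a : Polynomial Fq), a.Monic →
      polyToTate Fq n (D j) * (polyToTate Fq n a) ^ q ^ j * G (j, a) =
        tateBProd Fq n q j * tateAProd Fq n a)
    (hG' : ∀ (j : ℕ) (a : Polynomial Fq), ¬ a.Monic → G (j, a) = 0)
    (f : Polynomial (MvPolynomial (Fin n) Fq))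
    (hf : f = ∏ i : Fin n, (Polynomial.C (MvPolynomial.X i) - Polynomial.X))
    (u : Polynomial (MvPolynomial (Fin n) Fq))
    (hu : Polynomial.aeval (thetaTate Fq n) u = G.hsum) :
    ∀ b : Polynomial (MvPolynomial (Fin n) Fq),
      (∃ a : Polynomial (MvPolynomial (Fin n) Fq), a ≠ 0 ∧
        ∃ c : Polynomial (MvPolynomial (Fin n) Fq),
          Polynomial.aeval (carlitzDefTheta (MvPolynomial (Fin n) Fq) q f) a b =
            Polynomial.aeval (carlitzDefTheta (MvPolynomial (Fin n) Fq) q f) c u) →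
      ∃ c : Polynomial (MvPolynomial (Fin n) Fq),
        b = Polynomial.aeval (carlitzDefTheta (MvPolynomial (Fin n) Fq) q f) c u := by
  subst hq
  have hq1 : 2 ≤ Fintype.card Fq := Fintype.one_lt_card
  have hq3 : 3 ≤ Fintype.card Fq := by
    by_contra h
    have h2 : Fintype.card Fq = 2 := by omega
    rw [h2] at hn1
    exact hn1 (by simp [Nat.mod_one])
  obtain ⟨r, k, hnrk, hr2, hrq⟩ : ∃ r k, n = r + k * (Fintype.card Fq - 1) ∧ 2 ≤ r ∧
      r ≤ Fintype.card Fq - 1 := by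
    have hdm := Nat.mod_add_div n (Fintype.card Fq - 1)
    have hlt := Nat.mod_lt n (show 0 < Fintype.card Fq - 1 by omega)
    rw [Nat.mod_eq_of_lt (show 1 < Fintype.card Fq - 1 by omega)] at hn1
    by_cases h0 : n % (Fintype.card Fq - 1) = 0
    · have hd : n / (Fintype.card Fq - 1) ≠ 0 := by
        intro h
        rw [h0, h] at hdm
        simp at hdm
        omega
      obtain ⟨k, hk⟩ := Nat.exists_eq_succ_of_ne_zero hd
      refine ⟨Fintype.card Fq - 1, k, ?_, by omega, le_rfl⟩
      rw [h0, hk] at hdm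
      rw [← hdm, Nat.succ_eq_add_one]; ring
    · exact ⟨n % (Fintype.card Fq - 1), n / (Fintype.card Fq - 1), by rw [mul_comm]; exact hdm.symm,
        by omega, by omega⟩
  have hn2 : 2 ≤ n := by rw [hnrk]; omega
  obtain ⟨hf1, hf2, hf3⟩ := f_facts hf
  have hfd : 2 ≤ f.natDegree := by rw [hf1]; exact hn2
  have hlu := lc_unit hD0 hD G hG hG' hn1 u hu
  have hsp := spec_u hD0 hD G hG hG' hnrk (by omega) hrq u hu
  rintro b ⟨a, ha, c, hac⟩
  obtain ⟨a', c', g, hrel, h1, h2⟩ := UniqueFactorizationMonoid.exists_reduced_factors a ha c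
  have hg0 : g ≠ 0 := by rintro rfl; simp at h1; exact ha h1.symm
  rw [← h1, ← h2, map_mul, map_mul, Module.End.mul_apply, Module.End.mul_apply] at hac
  have hac' := cdt_cancel hq1 hfd hg0 hac
  obtain ⟨v, hv⟩ := cdt_key hq1 hfd hf2 hrel hac'
  have hu0 : u ≠ 0 := by rintro rfl; simp at hlu
  have ha' : a' ≠ 0 := by rintro rfl; simp at hv; exact hu0 hv
  have hv0 : v ≠ 0 := by rintro rfl; simp at hv; exact hu0 hv
  have hlc : IsUnit a'.leadingCoeff := by
    have := (cdt_aeval_deg hq1 hfd _ ha' rfl hv0).2.2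
    rw [← hv] at this
    rw [this, mul_assoc] at hlu
    exact isUnit_of_mul_isUnit_left hlu
  have hmap : (a'.map (h0 Fq n)).natDegree = a'.natDegree :=
    natDegree_map_of_leadingCoeff_ne_zero _ (hlc.map (h0 Fq n)).ne_zero
  have hmap0 : a'.map (h0 Fq n) ≠ 0 := by
    intro h
    have h3 := congrArg (fun p => p.coeff a'.natDegree) h
    simp only [coeff_map, coeff_zero] at h3
    exact (hlc.map (h0 Fq n)).ne_zero h3
  have hu0' : u.map (h0 Fq n) = aeval (carlitzDefTheta Fq (Fintype.card Fq) ((-X) ^ n))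
      (a'.map (h0 Fq n)) (v.map (h0 Fq n)) := by
    rw [← hf3, ← map_cdt, ← hv]
  have hdeg := prim_Fq hnrk hr2 hmap0 hsp hu0'
  rw [hmap] at hdeg
  have hunit : IsUnit a' := by
    rw [eq_C_of_natDegree_eq_zero hdeg]
    rw [leadingCoeff, hdeg] at hlc
    exact hlc.map C
  obtain ⟨w, hw⟩ := hunit.exists_left_inv
  refine ⟨w * c', ?_⟩
  rw [map_mul, Module.End.mul_apply, ← hac', ← Module.End.mul_apply, ← map_mul, hw, map_one,
    Module.End.one_apply]
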